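/- arXiv:1105.4159 — 2 statements merged into one kernel-verified Lean document; each statement's English description precedes it below -/
import Mathlib

section
/- Fix n ≥ 1 and work on the periodic lattice (ℤ/2ⁿℤ)³: let V_n be the 𝔽₂-vector space of functions (ℤ/2ⁿℤ)³ → 𝔽₂ and define σ and e⁽ᵖ⁾_u on V_n by the same formulas. Then σ(e⁽ⁿ⁾_u) = 0 for every u ∈ (ℤ/2ⁿℤ)³; that is, on the periodic lattice of linear size L = 2ⁿ the fractal error e⁽ⁿ⁾_u creates no defects. -/
namespace BH

/-- The `𝔽₂`-vector space of functions `(ℤ/2ⁿℤ)³ → 𝔽₂`. -/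
abbrev W (n : ℕ) := (Fin 3 → ZMod (2 ^ n)) → ZMod 2

/-- The coordinate unit vector `x̂`. -/
def xhat (n : ℕ) : Fin 3 → ZMod (2 ^ n) := ![1, 0, 0]

/-- The coordinate unit vector `ŷ`. -/
def yhat (n : ℕ) : Fin 3 → ZMod (2 ^ n) := ![0, 1, 0]

/-- The coordinate unit vector `ẑ`. -/
def zhat (n : ℕ) : Fin 3 → ZMod (2 ^ n) := ![0, 0, 1]

/-- The indicator function `δ_u`. -/
def δ {n : ℕ} (u : Fin 3 → ZMod (2 ^ n)) : W n := fun v => if v = u then 1 else 0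

/-- The syndrome map `σ` of Code 1 restricted to `X`-errors on first qubits:
the `𝔽₂`-linear map determined by `σ(δ_u) = δ_u + δ_{u+x̂} + δ_{u+ŷ} + δ_{u+ẑ}`. -/
def σmap {n : ℕ} (f : W n) : W n :=
  fun v => f v + f (v - xhat n) + f (v - yhat n) + f (v - zhat n)

/-- The fractal error on the periodic lattice: `e⁽⁰⁾_u = δ_u` and
`e⁽ᵖ⁺¹⁾_u = e⁽ᵖ⁾_u + e⁽ᵖ⁾_{u+2ᵖx̂} + e⁽ᵖ⁾_{u+2ᵖŷ} + e⁽ᵖ⁾_{u+2ᵖẑ}`,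
with `2ᵖ` taken modulo `2ⁿ`. -/
def e {n : ℕ} : ℕ → (Fin 3 → ZMod (2 ^ n)) → W n
  | 0, u => δ u
  | p + 1, u =>
      e p u + e p (u + (2 ^ p : ZMod (2 ^ n)) • xhat n)
        + e p (u + (2 ^ p : ZMod (2 ^ n)) • yhat n)
        + e p (u + (2 ^ p : ZMod (2 ^ n)) • zhat n)

/-- Sanity check: `σ` is the linear extension of
`σ(δ_u) = δ_u + δ_{u+x̂} + δ_{u+ŷ} + δ_{u+ẑ}`. -/
theorem σmap_delta {n : ℕ} (u : Fin 3 → ZMod (2 ^ n)) :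
    σmap (δ u) = δ u + δ (u + xhat n) + δ (u + yhat n) + δ (u + zhat n) := by
  funext v
  simp only [σmap, δ, Pi.add_apply, sub_eq_iff_eq_add]

theorem σmap_add {n : ℕ} (f g : W n) : σmap (f + g) = σmap f + σmap g := by
  funext v
  simp only [σmap, Pi.add_apply]
  ring

theorem W_add_self {n : ℕ} (f : W n) : f + f = 0 := by
  funext v
  exact CharTwo.add_self_eq_zero (f v)

/-- Cross terms cancel in characteristic two. -/
theorem W_cancel {n : ℕ} (a b c d p q r s t w : W n) :
    (a + p + q + r) + (p + b + s + t) + (q + s + c + w) + (r + t + w + d)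
      = a + b + c + d := by
  have h : (a + p + q + r) + (p + b + s + t) + (q + s + c + w) + (r + t + w + d)
      = a + b + c + d + (p + p) + (q + q) + (r + r) + (s + s) + (t + t) + (w + w) := by
    abel
  rw [h]
  simp only [W_add_self, add_zero]

theorem σmap_e {n : ℕ} (p : ℕ) : ∀ u : Fin 3 → ZMod (2 ^ n),
    σmap (e p u) = δ u + δ (u + (2 ^ p : ZMod (2 ^ n)) • xhat n)
      + δ (u + (2 ^ p : ZMod (2 ^ n)) • yhat n)
      + δ (u + (2 ^ p : ZMod (2 ^ n)) • zhat n) := by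
  induction p with
  | zero =>
    intro u
    simp only [e, pow_zero, one_smul, σmap_delta]
  | succ p ih =>
    intro u
    have hs : ∀ a : Fin 3 → ZMod (2 ^ n), (2 ^ (p + 1) : ZMod (2 ^ n)) • a
        = (2 ^ p : ZMod (2 ^ n)) • a + (2 ^ p : ZMod (2 ^ n)) • a := by
      intro a
      rw [← add_smul, pow_succ, mul_two]
    simp only [e, σmap_add, ih, hs]
    generalize (2 ^ p : ZMod (2 ^ n)) • xhat n = x
    generalize (2 ^ p : ZMod (2 ^ n)) • yhat n = y
    generalize (2 ^ p : ZMod (2 ^ n)) • zhat n = z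
    rw [add_right_comm u y x, add_right_comm u z x, add_right_comm u z y]
    simp only [← add_assoc u]
    have h := W_cancel (δ u) (δ (u + x + x)) (δ (u + y + y)) (δ (u + z + z))
      (δ (u + x)) (δ (u + y)) (δ (u + z)) (δ (u + x + y)) (δ (u + x + z)) (δ (u + y + z))
    exact h

/-- On the periodic lattice `(ℤ/2ⁿℤ)³` of linear size
`L = 2ⁿ`, the fractal error `e⁽ⁿ⁾_u` creates no defects: `σ(e⁽ⁿ⁾_u) = 0` for
every `u`. -/
theorem fractal_closes_on_torus (n : ℕ) (hn : 1 ≤ n) (u : Fin 3 → ZMod (2 ^ n)) :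
    σmap (e n u) = 0 := by
  have h2 : (2 ^ n : ZMod (2 ^ n)) = 0 := by
    have h := ZMod.natCast_self (2 ^ n)
    push_cast at h
    exact h
  rw [σmap_e, h2]
  simp only [zero_smul, add_zero, W_add_self, zero_add]

end BH
end

section
/- Let L = 2ⁿ with n ≥ 1 and consider Code 1 on Λ = (ℤ/Lℤ)³. For every site u, the operator E⁽ⁿ⁾_u commutes with every generator G^Z_c and G^X_c of Code 1, yet E⁽ⁿ⁾_u does not belong to the stabilizer group 𝒢; that is, E⁽ⁿ⁾_u is a logical operator of Code 1. -/
namespace BH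

/-- The lattice `Λ = (ℤ/Lℤ)³`. -/
abbrev Site3 (L : ℕ) := Fin 3 → ZMod L

/-- Pauli operators modulo phase on the qubits of Code 1 (two qubits per
site), written additively: `E = (Eˣ, Eᶻ)` componentwise over `𝔽₂ × 𝔽₂`. -/
abbrev Pauli1 (L : ℕ) := (Site3 L × Fin 2) → ZMod 2 × ZMod 2

/-- The symplectic form `ω(E,F) = Σ_q (Eˣ_q Fᶻ_q + Eᶻ_q Fˣ_q)`;
`E` and `F` commute iff `ω(E,F) = 0`, and anticommute iff `ω(E,F) = 1`. -/
def sympForm {L : ℕ} [NeZero L] (E F : Pauli1 L) : ZMod 2 :=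
  ∑ q, ((E q).1 * (F q).2 + (E q).2 * (F q).1)

/-- The lattice vector with given coordinates. -/
def vv {L : ℕ} (a b c : ℕ) : Site3 L := ![(a : ZMod L), (b : ZMod L), (c : ZMod L)]

/-- The `Z`-type generator `G^Z_c` of Code 1: `Z` on the first qubit of the
sites `c+(1,0,1), c+(1,1,1), c+(1,1,0), c+(0,1,1)` and `Z` on the second qubit
of the sites `c+(1,1,1), c+(1,0,0), c+(0,1,0), c+(0,0,1)`. -/
def GZ {L : ℕ} (c : Site3 L) : Pauli1 L := fun q =>
  if (q.2 = 0 ∧ (q.1 = c + vv 1 0 1 ∨ q.1 = c + vv 1 1 1 ∨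
        q.1 = c + vv 1 1 0 ∨ q.1 = c + vv 0 1 1)) ∨
     (q.2 = 1 ∧ (q.1 = c + vv 1 1 1 ∨ q.1 = c + vv 1 0 0 ∨
        q.1 = c + vv 0 1 0 ∨ q.1 = c + vv 0 0 1))
  then (0, 1) else (0, 0)

/-- The `X`-type generator `G^X_c` of Code 1: `X` on the first qubit of the
sites `c+(0,0,0), c+(1,0,1), c+(1,1,0), c+(0,1,1)` and `X` on the second qubit
of the sites `c+(0,0,0), c+(1,0,0), c+(0,1,0), c+(0,0,1)`. -/
def GX {L : ℕ} (c : Site3 L) : Pauli1 L := fun q =>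
  if (q.2 = 0 ∧ (q.1 = c + vv 0 0 0 ∨ q.1 = c + vv 1 0 1 ∨
        q.1 = c + vv 1 1 0 ∨ q.1 = c + vv 0 1 1)) ∨
     (q.2 = 1 ∧ (q.1 = c + vv 0 0 0 ∨ q.1 = c + vv 1 0 0 ∨
        q.1 = c + vv 0 1 0 ∨ q.1 = c + vv 0 0 1))
  then (1, 0) else (0, 0)

/-- The single-qubit Pauli operator `XI_u`: `X` on the first qubit of site `u`. -/
def XI {L : ℕ} (u : Site3 L) : Pauli1 L := fun q => if q = (u, 0) then (1, 0) else (0, 0)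

end BH

namespace BH

/-- The fractal Pauli error: `E⁽⁰⁾_u = XI_u` and
`E⁽ᵖ⁺¹⁾_u = E⁽ᵖ⁾_u · E⁽ᵖ⁾_{u+2ᵖx̂} · E⁽ᵖ⁾_{u+2ᵖŷ} · E⁽ᵖ⁾_{u+2ᵖẑ}`
(written additively). -/
def Efrac {L : ℕ} : ℕ → Site3 L → Pauli1 L
  | 0, u => XI u
  | p + 1, u =>
      Efrac p u + Efrac p (u + (2 ^ p : ZMod L) • vv 1 0 0)
        + Efrac p (u + (2 ^ p : ZMod L) • vv 0 1 0)
        + Efrac p (u + (2 ^ p : ZMod L) • vv 0 0 1)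

/-- The stabilizer group `𝒢` of Code 1, generated by all `G^Z_c` and `G^X_c`. -/
def stab1 (L : ℕ) : AddSubgroup (Pauli1 L) :=
  AddSubgroup.closure (Set.range (GZ (L := L)) ∪ Set.range (GX (L := L)))

lemma sympForm_add {L : ℕ} [NeZero L] (A E F : Pauli1 L) :
    sympForm A (E + F) = sympForm A E + sympForm A F := by
  unfold sympForm
  rw [← Finset.sum_add_distrib]
  refine Finset.sum_congr rfl fun q _ => ?_
  simp only [Pi.add_apply, Prod.fst_add, Prod.snd_add]
  ring

lemma Efrac_snd {L : ℕ} (p : ℕ) : ∀ (u : Site3 L) (q), (Efrac p u q).2 = 0 := by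
  induction p with
  | zero =>
    intro u q
    simp only [Efrac, XI]
    split_ifs <;> rfl
  | succ p ih =>
    intro u q
    simp [Efrac, ih]

/-- Indicator function with values in `𝔽₂`. -/
def ind {L : ℕ} (a w : Site3 L) : ZMod 2 := if w = a then 1 else 0

lemma sympForm_XI {L : ℕ} [NeZero L] (A : Pauli1 L) (w : Site3 L) :
    sympForm A (XI w) = (A (w, 0)).2 := by
  unfold sympForm
  rw [Finset.sum_eq_single (w, 0)]
  · simp [XI]
  · intro b _ hb
    simp [XI, hb]
  · simp

lemma site_ext {L : ℕ} (v w : Site3 L) : v = w ↔ v 0 = w 0 ∧ v 1 = w 1 ∧ v 2 = w 2 := by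
  constructor
  · rintro rfl
    exact ⟨rfl, rfl, rfl⟩
  · rintro ⟨h0, h1, h2⟩
    funext i
    fin_cases i
    · exact h0
    · exact h1
    · exact h2

lemma vv0 {L : ℕ} (a b c : ℕ) : (vv a b c : Site3 L) 0 = a := rfl

lemma vv1 {L : ℕ} (a b c : ℕ) : (vv a b c : Site3 L) 1 = b := rfl

lemma vv2 {L : ℕ} (a b c : ℕ) : (vv a b c : Site3 L) 2 = c := rfl

lemma GZ_snd {L : ℕ} (h1 : (1 : ZMod L) ≠ 0) (c w : Site3 L) :
    (GZ c (w, 0)).2 = ind (c + vv 1 1 1) w + ind (c + vv 1 1 1) (w + vv 1 0 0)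
      + ind (c + vv 1 1 1) (w + vv 0 1 0) + ind (c + vv 1 1 1) (w + vv 0 0 1) := by
  simp only [GZ, ind, site_ext, Pi.add_apply, vv0, vv1, vv2, Nat.cast_one, Nat.cast_zero,
    add_zero, add_left_inj]
  generalize w 0 = a, w 1 = b, w 2 = d, c 0 = a', c 1 = b', c 2 = d'
  have e : ∀ t : ZMod L, t ≠ t + 1 := fun t h => h1 (by simpa using h.symm)
  have e' : ∀ t : ZMod L, t + 1 ≠ t := fun t h => e t h.symm
  by_cases ha : a = a' <;> by_cases ha2 : a = a' + 1 <;>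
  by_cases hb : b = b' <;> by_cases hb2 : b = b' + 1 <;>
  by_cases hd : d = d' <;> by_cases hd2 : d = d' + 1 <;>
  simp_all

lemma synd {L : ℕ} [NeZero L] (h1 : (1 : ZMod L) ≠ 0) (c : Site3 L) (p : ℕ) :
    ∀ w : Site3 L, sympForm (GZ c) (Efrac p w) =
      ind (c + vv 1 1 1) w + ind (c + vv 1 1 1) (w + (2 ^ p : ZMod L) • vv 1 0 0)
      + ind (c + vv 1 1 1) (w + (2 ^ p : ZMod L) • vv 0 1 0)
      + ind (c + vv 1 1 1) (w + (2 ^ p : ZMod L) • vv 0 0 1) := by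
  induction p with
  | zero =>
    intro w
    simp only [Efrac, pow_zero, one_smul]
    rw [sympForm_XI, GZ_snd h1]
  | succ p ih =>
    intro w
    have key : ∀ v : Site3 L, (2 ^ (p + 1) : ZMod L) • v = (2 ^ p : ZMod L) • v + (2 ^ p : ZMod L) • v := by
      intro v
      rw [← add_smul]
      congr 1
      ring
    simp only [Efrac, sympForm_add, ih, key]
    generalize (2 ^ p : ZMod L) • (vv 1 0 0 : Site3 L) = x
    generalize (2 ^ p : ZMod L) • (vv 0 1 0 : Site3 L) = y
    generalize (2 ^ p : ZMod L) • (vv 0 0 1 : Site3 L) = z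
    generalize ind (c + vv 1 1 1) = D
    rw [add_right_comm w y x, add_right_comm w z x, add_right_comm w z y]
    simp only [← add_assoc]
    have h2 : (2 : ZMod 2) = 0 := rfl
    linear_combination (D (w + x) + D (w + y) + D (w + z) + D (w + x + y) + D (w + x + z)
      + D (w + y + z)) * h2

/-- Symplectic pairing with the membrane of `Z` on all first qubits with third coordinate `k`. -/
def memb {L : ℕ} [NeZero L] (k : ZMod L) : Pauli1 L →+ ZMod 2 where
  toFun E := ∑ v : Site3 L, if v 2 = k then (E (v, 0)).1 else 0
  map_zero' := by simp
  map_add' E F := by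
    rw [← Finset.sum_add_distrib]
    refine Finset.sum_congr rfl fun v _ => ?_
    split_ifs <;> simp

lemma memb_apply {L : ℕ} [NeZero L] (k : ZMod L) (E : Pauli1 L) :
    memb k E = ∑ v : Site3 L, if v 2 = k then (E (v, 0)).1 else 0 := rfl

lemma memb_GZ {L : ℕ} [NeZero L] (k : ZMod L) (c : Site3 L) : memb k (GZ c) = 0 := by
  rw [memb_apply]
  refine Finset.sum_eq_zero fun v _ => ?_
  simp only [GZ]
  split_ifs <;> rfl

lemma sum_ind {L : ℕ} [NeZero L] (k : ZMod L) (a : Site3 L) :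
    (∑ v : Site3 L, if v 2 = k then ind a v else 0) = if a 2 = k then 1 else 0 := by
  rw [Finset.sum_eq_single a]
  · simp [ind]
  · intro b _ hb
    simp [ind, hb]
  · simp

lemma GX_fst {L : ℕ} (h1 : (1 : ZMod L) ≠ 0) (c w : Site3 L) :
    (GX c (w, 0)).1 = ind (c + vv 0 0 0) w + ind (c + vv 1 0 1) w
      + ind (c + vv 1 1 0) w + ind (c + vv 0 1 1) w := by
  simp only [GX, ind, site_ext, Pi.add_apply, vv0, vv1, vv2, Nat.cast_one, Nat.cast_zero,
    add_zero]
  generalize w 0 = a, w 1 = b, w 2 = d, c 0 = a', c 1 = b', c 2 = d'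
  have e : ∀ t : ZMod L, t ≠ t + 1 := fun t h => h1 (by simpa using h.symm)
  have e' : ∀ t : ZMod L, t + 1 ≠ t := fun t h => e t h.symm
  by_cases ha : a = a' <;> by_cases ha2 : a = a' + 1 <;>
  by_cases hb : b = b' <;> by_cases hb2 : b = b' + 1 <;>
  by_cases hd : d = d' <;> by_cases hd2 : d = d' + 1 <;>
  simp_all

lemma memb_GX {L : ℕ} [NeZero L] (h1 : (1 : ZMod L) ≠ 0) (k : ZMod L) (c : Site3 L) :
    memb k (GX c) = 0 := by
  rw [memb_apply]
  have : ∀ v : Site3 L, (if v 2 = k then (GX c (v, 0)).1 else 0) =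
      (if v 2 = k then ind (c + vv 0 0 0) v else 0) + (if v 2 = k then ind (c + vv 1 0 1) v else 0)
      + (if v 2 = k then ind (c + vv 1 1 0) v else 0)
      + (if v 2 = k then ind (c + vv 0 1 1) v else 0) := by
    intro v
    rw [GX_fst h1]
    split_ifs <;> simp
  simp only [this, Finset.sum_add_distrib, sum_ind, Pi.add_apply, vv2]
  by_cases ha : c 2 + ((0 : ℕ) : ZMod L) = k <;> by_cases hb : c 2 + ((1 : ℕ) : ZMod L) = k <;>
    simp only [ha, hb, if_true, if_false] <;> decide

lemma memb_Efrac {L : ℕ} [NeZero L] (k : ZMod L) (p : ℕ) : ∀ u : Site3 L,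
    memb k (Efrac p u) = ∑ i ∈ Finset.range (2 ^ p), if u 2 + (i : ZMod L) = k then 1 else 0 := by
  induction p with
  | zero =>
    intro u
    have : ∀ v : Site3 L, (XI u (v, 0)).1 = ind u v := by
      intro v
      simp only [XI, ind, Prod.mk.injEq, and_true]
      split_ifs <;> rfl
    simp only [Efrac, memb_apply, this, sum_ind, pow_zero, Finset.sum_range_one, Nat.cast_zero, add_zero]
  | succ p ih =>
    intro u
    simp only [Efrac, map_add, ih, Pi.add_apply, Pi.smul_apply, vv2, Nat.cast_zero, Nat.cast_one,
      smul_eq_mul, mul_one, mul_zero, add_zero]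
    rw [pow_succ, mul_two, Finset.sum_range_add]
    simp only [Nat.cast_add, Nat.cast_pow, Nat.cast_ofNat, ← add_assoc]
    have h2 : (2 : ZMod 2) = 0 := rfl
    linear_combination (∑ i ∈ Finset.range (2 ^ p),
      if u 2 + (i : ZMod L) = k then (1 : ZMod 2) else 0) * h2

/-- Let `L = 2ⁿ`, `n ≥ 1`. For every site `u`, the fractal
operator `E⁽ⁿ⁾_u` commutes with every generator `G^Z_c` and `G^X_c` of Code 1
but is not a stabilizer; that is, `E⁽ⁿ⁾_u` is a logical operator of Code 1. -/
theorem Efrac_is_logical (n L : ℕ) [NeZero L] (hL : L = 2 ^ n) (hn : 1 ≤ n)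
    (u : Site3 L) :
    (∀ c : Site3 L, sympForm (GZ c) (Efrac n u) = 0) ∧
    (∀ c : Site3 L, sympForm (GX c) (Efrac n u) = 0) ∧
    Efrac n u ∉ stab1 L := by
  have hL2 : 1 < L := by
    rw [hL]
    exact Nat.one_lt_two_pow (by omega)
  have h1 : (1 : ZMod L) ≠ 0 := by
    have : Fact (1 < L) := ⟨hL2⟩
    exact one_ne_zero
  have hz : (2 ^ n : ZMod L) = 0 := by
    have := ZMod.natCast_self L
    rw [congrArg (Nat.cast : ℕ → ZMod L) hL] at this
    simpa using this
  refine ⟨fun c => ?_, fun c => ?_, fun hmem => ?_⟩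
  · rw [synd h1, hz]
    simp only [zero_smul, add_zero]
    have h2 : (2 : ZMod 2) = 0 := rfl
    linear_combination (2 * ind (c + vv 1 1 1) u) * h2
  · unfold sympForm
    refine Finset.sum_eq_zero fun q _ => ?_
    have : (GX c q).2 = 0 := by
      simp only [GX]
      split_ifs <;> rfl
    rw [Efrac_snd, this]
    simp
  · have hker : stab1 L ≤ (memb (u 2)).ker := by
      unfold stab1
      rw [AddSubgroup.closure_le]
      rintro _ (⟨c, rfl⟩ | ⟨c, rfl⟩)
      · exact memb_GZ _ c
      · exact memb_GX h1 _ c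
    have h0 : memb (u 2) (Efrac n u) = 0 := hker hmem
    rw [memb_Efrac, Finset.sum_eq_single 0] at h0
    · simp at h0
    · intro i hi hi0
      rw [Finset.mem_range, ← hL] at hi
      rw [if_neg]
      intro h
      have h' : (i : ZMod L) = 0 := by simpa using h
      rw [ZMod.natCast_eq_zero_iff] at h'
      exact hi0 (Nat.eq_zero_of_dvd_of_lt h' hi)
    · simp

end BH
end
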